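/- Let d ≥ 0 and let ({θ_i}_{i=0}^d, {θ*_i}_{i=0}^d, {φ_i}_{i=1}^d) be scalars in a field K. Then there exists a TH system Φ over K with this parameter array if and only if (i) θ_i ≠ θ_j for i ≠ j, (ii) θ*_i ≠ θ*_j for i ≠ j, and (iii) φ_i ≠ 0 for 1 ≤ i ≤ d. Moreover in that case Φ is unique up to isomorphism of TH systems. -/

import Mathlib

/-- A thin Hessenberg system on `V`: multiplicity-free `A`, `Astar` with
orderings of primitive idempotents `E`, `Estar` (eigenvalues `θ`, `θs`)
satisfying the Hessenberg conditions. -/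
structure THSystem (K V : Type*) [Field K] [AddCommGroup V] [Module K V] (d : ℕ) where
  A : Module.End K V
  Astar : Module.End K V
  E : Fin (d + 1) → Module.End K V
  Estar : Fin (d + 1) → Module.End K V
  θ : Fin (d + 1) → K
  θs : Fin (d + 1) → K
  finrank_eq : Module.finrank K V = d + 1
  θ_inj : Function.Injective θ
  θs_inj : Function.Injective θs
  sum_E : ∑ i, E i = 1
  E_mul : ∀ i j, E i * E j = if i = j then E i else 0
  E_ne : ∀ i, E i ≠ 0
  sum_Es : ∑ i, Estar i = 1
  Es_mul : ∀ i j, Estar i * Estar j = if i = j then Estar i else 0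
  Es_ne : ∀ i, Estar i ≠ 0
  A_eq : A = ∑ i, θ i • E i
  As_eq : Astar = ∑ i, θs i • Estar i
  EAsE_zero : ∀ i j : Fin (d + 1), (j : ℕ) + 1 < (i : ℕ) → E i * Astar * E j = 0
  EAsE_ne : ∀ i j : Fin (d + 1), (i : ℕ) = (j : ℕ) + 1 → E i * Astar * E j ≠ 0
  EsAEs_zero : ∀ i j : Fin (d + 1), (j : ℕ) + 1 < (i : ℕ) → Estar i * A * Estar j = 0
  EsAEs_ne : ∀ i j : Fin (d + 1), (i : ℕ) = (j : ℕ) + 1 → Estar i * A * Estar j ≠ 0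
/-- The split decomposition subspaces
`U_i = (Σ_{h ≤ i} E*_h V) ⊓ (Σ_{h ≤ d-i} E_h V)`. -/
def splitU {K V : Type*} [Field K] [AddCommGroup V] [Module K V] {d : ℕ}
    (Φ : THSystem K V d) (i : Fin (d + 1)) : Submodule K V :=
  (⨆ h : Fin (d + 1), ⨆ _ : (h : ℕ) ≤ (i : ℕ), LinearMap.range (Φ.Estar h)) ⊓
  (⨆ h : Fin (d + 1), ⨆ _ : (h : ℕ) ≤ d - (i : ℕ), LinearMap.range (Φ.E h))
/-- `φ` is the split sequence of `Φ`:
`(A - θ_{d-i+1}) (A* - θ*_i)` acts on `U_i` as `φ_i`, for `1 ≤ i ≤ d`. -/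
def IsSplitSeq {K V : Type*} [Field K] [AddCommGroup V] [Module K V] {d : ℕ}
    (Φ : THSystem K V d) (φ : Fin (d + 1) → K) : Prop :=
  ∀ i : Fin (d + 1), ∀ hi : 1 ≤ (i : ℕ), ∀ u ∈ splitU Φ i,
    (Φ.A - Φ.θ ⟨d - (i : ℕ) + 1, by have := i.isLt; omega⟩ • (1 : Module.End K V))
      ((Φ.Astar - Φ.θs i • (1 : Module.End K V)) u) = φ i • u

section Helpers

open Module

variable {K V : Type*} [Field K] [AddCommGroup V] [Module K V]

namespace CompleteOrthogonalIdempotents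

variable {ι : Type*} [Fintype ι] {P : ι → Module.End K V}

lemma apply_self (hP : CompleteOrthogonalIdempotents P) (i : ι) (x : V) :
    P i (P i x) = P i x :=
  LinearMap.congr_fun (hP.idem i) x

lemma apply_of_ne (hP : CompleteOrthogonalIdempotents P) {i j : ι} (h : i ≠ j) (x : V) :
    P i (P j x) = 0 :=
  LinearMap.congr_fun (hP.ortho h) x

lemma sum_apply_eq (hP : CompleteOrthogonalIdempotents P) (x : V) : ∑ i, P i x = x := by
  simpa using LinearMap.congr_fun hP.complete x

lemma eq_zero_of_forall (hP : CompleteOrthogonalIdempotents P) {x : V}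
    (h : ∀ i, P i x = 0) : x = 0 := by
  rw [← hP.sum_apply_eq x]
  exact Finset.sum_eq_zero fun i _ => h i

lemma mem_iSup_range_iff (hP : CompleteOrthogonalIdempotents P) (p : ι → Prop) (x : V) :
    x ∈ (⨆ h, ⨆ _ : p h, LinearMap.range (P h)) ↔ ∀ h, ¬ p h → P h x = 0 := by
  constructor
  · intro hx h hh
    have hle : (⨆ h, ⨆ _ : p h, LinearMap.range (P h)) ≤ LinearMap.ker (P h) := by
      refine iSup₂_le fun k hk => ?_
      rintro _ ⟨y, rfl⟩
      exact hP.apply_of_ne (by rintro rfl; exact hh hk) y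
    exact hle hx
  · intro hx
    rw [← hP.sum_apply_eq x]
    refine Submodule.sum_mem _ fun h _ => ?_
    by_cases hh : p h
    · exact Submodule.mem_iSup_of_mem h (Submodule.mem_iSup_of_mem hh ⟨x, rfl⟩)
    · simp [hx h hh]

/-- `P j` diagonalizes `∑ θ i • P i` with eigenvalue `θ j`. -/
lemma apply_sum_smul (hP : CompleteOrthogonalIdempotents P) (θ : ι → K) (j : ι) (x : V) :
    P j ((∑ i, θ i • P i) x) = θ j • P j x := by
  classical
  simp only [LinearMap.sum_apply, LinearMap.smul_apply, map_sum, map_smul]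
  rw [Finset.sum_eq_single j]
  · rw [hP.apply_self]
  · intro i _ hi
    rw [hP.apply_of_ne hi.symm, smul_zero]
  · simp

/-- If the number of nonzero idempotents is the dimension, each has rank one. -/
lemma exists_smul_eq (hP : CompleteOrthogonalIdempotents P) (hne : ∀ i, P i ≠ 0)
    (hd : finrank K V = Fintype.card ι) {i : ι} {w : V} (hw : P i w ≠ 0) (x : V) :
    ∃ c : K, P i x = c • P i w := by
  classical
  have hex : ∀ k, ∃ y, P k y ≠ 0 := fun k => by
    by_contra! h
    exact hne k (LinearMap.ext h)
  choose y hy using hex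
  let z : ι → V := Function.update y i w
  have hz : ∀ k, P k (z k) ≠ 0 := fun k => by
    by_cases hk : k = i
    · subst hk; simpa [z] using hw
    · simpa [z, hk] using hy k
  have key : ∀ (c : ι → K) k, P k (∑ l, c l • P l (z l)) = c k • P k (z k) := by
    intro c k
    rw [map_sum, Finset.sum_eq_single k]
    · rw [map_smul, hP.apply_self]
    · intro l _ hl
      rw [map_smul, hP.apply_of_ne hl.symm, smul_zero]
    · simp
  have hli : LinearIndependent K fun k => P k (z k) := by
    rw [Fintype.linearIndependent_iff]
    intro c hc k
    have := key c k
    rw [hc, map_zero] at this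
    exact (smul_eq_zero.1 this.symm).resolve_right (hz k)
  have : Nonempty ι := ⟨i⟩
  let b := basisOfLinearIndependentOfCardEqFinrank hli hd.symm
  refine ⟨b.repr x i, ?_⟩
  have h := key (b.repr x) i
  have hx : ∑ l, b.repr x l • P l (z l) = x := by
    simpa [b] using b.sum_repr x
  rw [hx] at h
  simpa [z] using h

/-- A map intertwining two diagonalizable maps intertwines their eigenprojections. -/
lemma intertwine (hP : CompleteOrthogonalIdempotents P)
    {W : Type*} [AddCommGroup W] [Module K W] {Q : ι → Module.End K W}
    (hQ : CompleteOrthogonalIdempotents Q) {θ : ι → K} (hθ : Function.Injective θ)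
    (γ : V →ₗ[K] W) (h : ∀ x, γ ((∑ i, θ i • P i) x) = (∑ i, θ i • Q i) (γ x)) (i : ι) (x : V) :
    γ (P i x) = Q i (γ x) := by
  classical
  have hz : ∀ j k, j ≠ k → ∀ x, Q j (γ (P k x)) = 0 := by
    intro j k hjk x
    have h1 := congrArg (Q j) (h (P k x))
    rw [hQ.apply_sum_smul] at h1
    have h2 : (∑ i, θ i • P i) (P k x) = θ k • P k x := by
      simp only [LinearMap.sum_apply, LinearMap.smul_apply]
      rw [Finset.sum_eq_single k]
      · rw [hP.apply_self]
      · intro l _ hl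
        rw [hP.apply_of_ne hl, smul_zero]
      · simp
    rw [h2, map_smul, map_smul, ← sub_eq_zero, ← sub_smul] at h1
    exact (smul_eq_zero.1 h1).resolve_left (sub_ne_zero.2 fun e => hjk (hθ e).symm)
  have h1 : γ (P i x) = Q i (γ (P i x)) := by
    conv_lhs => rw [← hQ.sum_apply_eq (γ (P i x))]
    exact Finset.sum_eq_single i (fun j _ hj => hz j i hj x) (by simp)
  have h2 : Q i (γ x) = Q i (γ (P i x)) := by
    conv_lhs => rw [← hP.sum_apply_eq x]
    rw [map_sum, map_sum]
    exact Finset.sum_eq_single i (fun j _ hj => hz i j hj.symm x) (by simp)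
  rw [h1, h2]

end CompleteOrthogonalIdempotents

variable {n : ℕ}

/-- The family `v` is triangular with nonzero diagonal with respect to the projections `P`. -/
structure IsAdapted (P : Fin n → Module.End K V) (v : Fin n → V) : Prop where
  apply_eq_zero : ∀ i j, i < j → P j (v i) = 0
  apply_ne_zero : ∀ i, P i (v i) ≠ 0

namespace IsAdapted

variable {P : Fin n → Module.End K V} {v : Fin n → V}

lemma coeff_eq_zero (h : IsAdapted P v) (c : Fin n → K) (m : ℕ)
    (hc : ∀ j : Fin n, m ≤ j → P j (∑ k, c k • v k) = 0) (k : Fin n) (hk : m ≤ k) : c k = 0 := by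
  induction k using WellFoundedGT.induction with
  | ind k ih =>
    have h1 := hc k hk
    rw [map_sum, Finset.sum_eq_single k] at h1
    · rw [map_smul] at h1
      exact (smul_eq_zero.1 h1).resolve_right (h.apply_ne_zero k)
    · intro l _ hl
      rw [map_smul]
      rcases lt_or_gt_of_ne hl with hlt | hgt
      · rw [h.apply_eq_zero l k hlt, smul_zero]
      · rw [ih l hgt (by have : (k : ℕ) < l := hgt; omega), zero_smul]
    · simp

lemma linearIndependent (h : IsAdapted P v) : LinearIndependent K v := by
  rw [Fintype.linearIndependent_iff]
  intro c hc k
  exact h.coeff_eq_zero c 0 (fun j _ => by rw [hc, map_zero]) k (Nat.zero_le _)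

lemma mem_span {b : Basis (Fin n) K V} (h : IsAdapted P b) (i : Fin n) {x : V}
    (hx : ∀ j, i < j → P j x = 0) : x ∈ Submodule.span K (b '' Set.Iic i) := by
  rw [← b.sum_repr x]
  refine Submodule.sum_mem _ fun k _ => ?_
  by_cases hk : k ≤ i
  · exact Submodule.smul_mem _ _ (Submodule.subset_span ⟨k, hk, rfl⟩)
  · have : b.repr x k = 0 := by
      refine h.coeff_eq_zero (b.repr x) (i + 1) (fun j hj => ?_) k ?_
      · rw [b.sum_repr]; exact hx j hj
      · exact not_le.1 hk
    simp [this]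

lemma of_triangular (hP : CompleteOrthogonalIdempotents P) (hne : ∀ i, P i ≠ 0)
    {θ : Fin n → K} (hθ : Function.Injective θ) (b : Basis (Fin n) K V)
    (hb : ∀ i, (∑ k, θ k • P k) (b i) - θ i • b i ∈ Submodule.span K (b '' Set.Iio i)) :
    IsAdapted P b := by
  have step : ∀ i j, i ≠ j → (∀ k < i, P j (b k) = 0) → P j (b i) = 0 := by
    intro i j hij hk
    have hle : Submodule.span K (b '' Set.Iio i) ≤ LinearMap.ker (P j) := by
      rw [Submodule.span_le]
      rintro _ ⟨k, hki, rfl⟩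
      exact hk k hki
    have h1 : P j _ = 0 := hle (hb i)
    rw [map_sub, hP.apply_sum_smul, map_smul, ← sub_smul] at h1
    exact (smul_eq_zero.1 h1).resolve_left (sub_ne_zero.2 fun e => hij (hθ e).symm)
  have hlt : ∀ i j, i < j → P j (b i) = 0 := by
    intro i j
    induction i using WellFoundedLT.induction with
    | ind i ih =>
      intro hij
      exact step i j hij.ne fun k hk => ih k hk (hk.trans hij)
  refine ⟨hlt, fun j hj => hne j (b.ext fun i => ?_)⟩
  induction i using WellFoundedLT.induction with
  | ind i ih =>
    by_cases hij : i = j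
    · subst hij; exact hj
    · exact step i j hij ih

lemma mul_mul_eq_zero {b : Basis (Fin n) K V} (h : IsAdapted P b)
    (hP : CompleteOrthogonalIdempotents P) {S : Module.End K V}
    (hS : ∀ i j : Fin n, (j : ℕ) = i + 1 →
      ∃ c : K, c ≠ 0 ∧ S (b i) - c • b j ∈ Submodule.span K (b '' Set.Iic i))
    (i j : Fin n) (hij : (j : ℕ) + 1 < i) : P i * S * P j = 0 := by
  have hle : ∀ k : Fin n, k < i → Submodule.span K (b '' Set.Iic k) ≤ LinearMap.ker (P i) := by
    intro k hk
    rw [Submodule.span_le]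
    rintro _ ⟨l, hl, rfl⟩
    exact h.apply_eq_zero l i (lt_of_le_of_lt hl hk)
  ext x
  have hx : P j x ∈ Submodule.span K (b '' Set.Iic j) :=
    h.mem_span j fun k hk => hP.apply_of_ne hk.ne' x
  have hle' : Submodule.span K (b '' Set.Iic j) ≤ LinearMap.ker (P i * S) := by
    rw [Submodule.span_le]
    rintro _ ⟨k, hk, rfl⟩
    have hkj : (k : ℕ) ≤ j := hk
    obtain ⟨c, -, hc⟩ := hS k ⟨k + 1, by omega⟩ rfl
    have h1 : P i _ = 0 := hle k (by rw [Fin.lt_def]; omega) hc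
    rw [map_sub, map_smul, h.apply_eq_zero _ i (by rw [Fin.lt_def]; dsimp only; omega),
      smul_zero, sub_zero] at h1
    exact h1
  exact hle' hx

lemma mul_mul_ne_zero {b : Basis (Fin n) K V} (h : IsAdapted P b)
    (hP : CompleteOrthogonalIdempotents P) {S : Module.End K V}
    (hS : ∀ i j : Fin n, (j : ℕ) = i + 1 →
      ∃ c : K, c ≠ 0 ∧ S (b i) - c • b j ∈ Submodule.span K (b '' Set.Iic i))
    (i j : Fin n) (hij : (i : ℕ) = j + 1) : P i * S * P j ≠ 0 := by
  intro h0
  obtain ⟨c, hc0, hc⟩ := hS j i hij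
  have hle : Submodule.span K (b '' Set.Iic j) ≤ LinearMap.ker (P i) := by
    rw [Submodule.span_le]
    rintro _ ⟨l, hl, rfl⟩
    have hl' : (l : ℕ) ≤ j := hl
    exact h.apply_eq_zero l i (by rw [Fin.lt_def]; omega)
  have h1 : P i _ = 0 := hle hc
  rw [map_sub, map_smul, sub_eq_zero] at h1
  have h2 : P i (S (b j)) = 0 := by
    conv_lhs => rw [← hP.sum_apply_eq (b j)]
    rw [map_sum, map_sum]
    refine Finset.sum_eq_zero fun k _ => ?_
    rcases lt_trichotomy k j with hk | rfl | hk
    · exact LinearMap.congr_fun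
        (h.mul_mul_eq_zero hP hS i k (by have : (k : ℕ) < j := hk; omega)) (b j)
    · exact LinearMap.congr_fun h0 (b k)
    · rw [h.apply_eq_zero j k hk, map_zero, map_zero]
  rw [h2] at h1
  exact smul_ne_zero hc0 (h.apply_ne_zero i) h1.symm

end IsAdapted

/-- A triangular map with distinct diagonal entries is diagonalizable. -/
lemma exists_idempotents_of_triangular (b : Basis (Fin n) K V) (T : Module.End K V)
    {θ : Fin n → K} (hθ : Function.Injective θ)
    (hT : ∀ i, T (b i) - θ i • b i ∈ Submodule.span K (b '' Set.Iio i)) :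
    ∃ P : Fin n → Module.End K V, CompleteOrthogonalIdempotents P ∧ (∀ i, P i ≠ 0) ∧
      T = ∑ i, θ i • P i := by
  classical
  have := b.finiteDimensional_of_finite
  have hrepr : ∀ i j, i ≤ j → b.repr (T (b i) - θ i • b i) j = 0 := by
    intro i j hij
    have hle : Submodule.span K (b '' Set.Iio i) ≤ LinearMap.ker (b.coord j) := by
      rw [Submodule.span_le]
      rintro _ ⟨k, hk, rfl⟩
      have : k ≠ j := (lt_of_lt_of_le hk hij).ne
      simp [this]
    exact hle (hT i)
  have hM : (LinearMap.toMatrix b b T).BlockTriangular id := by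
    intro i j hij
    have hij : j < i := hij
    have := hrepr j i hij.le
    simpa [LinearMap.toMatrix_apply, Finsupp.single_apply, hij.ne] using this
  have hdiag : ∀ i, LinearMap.toMatrix b b T i i = θ i := by
    intro i
    have := hrepr i i le_rfl
    simpa [LinearMap.toMatrix_apply, sub_eq_zero] using this
  have hev : ∀ i, ∃ x, T.HasEigenvector (θ i) x := by
    intro i
    refine Module.End.HasEigenvalue.exists_hasEigenvector ?_
    rw [Module.End.hasEigenvalue_iff_isRoot_charpoly, ← LinearMap.charpoly_toMatrix T b,
      Matrix.charpoly_of_isUpperTriangular _ hM, Polynomial.IsRoot, Polynomial.eval_prod]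
    refine Finset.prod_eq_zero (Finset.mem_univ i) ?_
    simp [hdiag]
  choose x hx using hev
  have hli := Module.End.eigenvectors_linearIndependent' T θ hθ x hx
  rcases isEmpty_or_nonempty (Fin n) with he | he
  · have : Subsingleton V := ⟨fun y z => b.repr.injective (Subsingleton.elim _ _)⟩
    exact ⟨0, ⟨⟨fun i => isEmptyElim i, fun i => isEmptyElim i⟩, Subsingleton.elim _ _⟩,
      fun i => isEmptyElim i, Subsingleton.elim _ _⟩
  let v := basisOfLinearIndependentOfCardEqFinrank hli (finrank_eq_card_basis b).symm
  have hv : ∀ i, v i = x i := fun i => by simp [v]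
  let P : Fin n → Module.End K V := fun i => (v.coord i).smulRight (v i)
  have hPv : ∀ i j, P i (v j) = if i = j then v j else 0 := by
    intro i j
    by_cases hij : i = j
    · subst hij; simp [P]
    · simp [P, hij]
  refine ⟨P, ⟨⟨fun i => v.ext fun k => ?_, fun i j hij => v.ext fun k => ?_⟩, v.ext fun k => ?_⟩,
    fun i h0 => ?_, v.ext fun k => ?_⟩
  · by_cases hik : i = k <;> simp [hPv, hik]
  · by_cases hjk : j = k
    · subst hjk; simp [hPv, hij]
    · simp [hPv, hjk]
  · simp [hPv]
  · have := LinearMap.congr_fun h0 (v i)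
    rw [hPv, if_pos rfl] at this
    exact v.ne_zero i this
  · rw [hv, (hx k).apply_eq_smul, ← hv]
    simp [hPv]

section SplitForm

variable {d : ℕ} (b : Basis (Fin (d + 1)) K V)

/-- The lower bidiagonal map of the split form. -/
noncomputable def splitLower (θ : Fin (d + 1) → K) : Module.End K V :=
  b.constr K fun i => θ i.rev • b i + if h : (i : ℕ) + 1 < d + 1 then b ⟨i + 1, h⟩ else 0

/-- The upper bidiagonal map of the split form. -/
noncomputable def splitUpper (θs φ : Fin (d + 1) → K) : Module.End K V :=
  b.constr K fun i => θs i • b i +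
    if 0 < (i : ℕ) then φ i • b ⟨i - 1, by have := i.isLt; omega⟩ else 0

lemma splitLower_apply (θ : Fin (d + 1) → K) (i : Fin (d + 1)) :
    splitLower b θ (b i) =
      θ i.rev • b i + if h : (i : ℕ) + 1 < d + 1 then b ⟨i + 1, h⟩ else 0 :=
  b.constr_basis K _ i

lemma splitUpper_apply (θs φ : Fin (d + 1) → K) (i : Fin (d + 1)) :
    splitUpper b θs φ (b i) = θs i • b i +
      if 0 < (i : ℕ) then φ i • b ⟨i - 1, by have := i.isLt; omega⟩ else 0 :=
  b.constr_basis K _ i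

lemma splitUpper_sub_mem (θs φ : Fin (d + 1) → K) (i : Fin (d + 1)) :
    splitUpper b θs φ (b i) - θs i • b i ∈ Submodule.span K (b '' Set.Iio i) := by
  rw [splitUpper_apply, add_sub_cancel_left]
  split_ifs with h
  · refine Submodule.smul_mem _ _ (Submodule.subset_span ⟨_, ?_, rfl⟩)
    rw [Set.mem_Iio, Fin.lt_def]
    dsimp only
    omega
  · exact Submodule.zero_mem _

lemma splitLower_sub_mem (θ : Fin (d + 1) → K) (i : Fin (d + 1)) :
    splitLower b θ (b.reindex Fin.revPerm i) - θ i • b.reindex Fin.revPerm i ∈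
      Submodule.span K (b.reindex Fin.revPerm '' Set.Iio i) := by
  rw [Basis.reindex_apply, splitLower_apply]
  simp only [Fin.revPerm_symm, Fin.revPerm_apply, Fin.rev_rev, add_sub_cancel_left]
  split_ifs with h
  · refine Submodule.subset_span ⟨(⟨i.rev + 1, h⟩ : Fin (d + 1)).rev, ?_, by simp⟩
    rw [Set.mem_Iio, Fin.lt_def]
    simp only [Fin.val_rev] at h ⊢
    omega
  · exact Submodule.zero_mem _

lemma splitLower_raises (θ : Fin (d + 1) → K) (i j : Fin (d + 1)) (hij : (j : ℕ) = i + 1) :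
    ∃ c : K, c ≠ 0 ∧
      splitLower b θ (b i) - c • b j ∈ Submodule.span K (b '' Set.Iic i) := by
  refine ⟨1, one_ne_zero, ?_⟩
  have h : (i : ℕ) + 1 < d + 1 := hij ▸ j.isLt
  obtain rfl : j = ⟨i + 1, h⟩ := Fin.ext hij
  rw [splitLower_apply, dif_pos h, one_smul, add_sub_cancel_right]
  exact Submodule.smul_mem _ _ (Submodule.subset_span ⟨i, Set.mem_Iic.2 le_rfl, rfl⟩)

lemma splitUpper_raises (θs : Fin (d + 1) → K) {φ : Fin (d + 1) → K}
    (hφ : ∀ i : Fin (d + 1), 1 ≤ (i : ℕ) → φ i ≠ 0) (i j : Fin (d + 1)) (hij : (j : ℕ) = i + 1) :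
    ∃ c : K, c ≠ 0 ∧
      splitUpper b θs φ (b.reindex Fin.revPerm i) - c • b.reindex Fin.revPerm j ∈
        Submodule.span K (b.reindex Fin.revPerm '' Set.Iic i) := by
  have hj := j.isLt
  have h : 0 < (i.rev : ℕ) := by rw [Fin.val_rev]; omega
  refine ⟨φ i.rev, hφ _ h, ?_⟩
  have hr : j.rev = ⟨i.rev - 1, by omega⟩ := by
    ext; simp only [Fin.val_rev]; omega
  have h1 : splitUpper b θs φ (b.reindex Fin.revPerm i) - φ i.rev • b.reindex Fin.revPerm j =
      θs i.rev • b.reindex Fin.revPerm i := by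
    simp only [Basis.reindex_apply, Fin.revPerm_symm, Fin.revPerm_apply]
    rw [splitUpper_apply, if_pos h, hr, add_sub_cancel_right]
  rw [h1]
  exact Submodule.smul_mem _ _ (Submodule.subset_span ⟨i, Set.mem_Iic.2 le_rfl, rfl⟩)

variable {b} in
/-- Two opposite flags adapted to the same basis meet in the lines spanned by its members. -/
lemma IsAdapted.exists_eq_smul {P Q : Fin (d + 1) → Module.End K V} (hP : IsAdapted P b)
    (hQ : IsAdapted Q (b.reindex Fin.revPerm)) (i : Fin (d + 1)) {x : V}
    (h1 : ∀ j, i < j → P j x = 0) (h2 : ∀ j, i.rev < j → Q j x = 0) : ∃ c : K, x = c • b i := by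
  have m1 := hP.mem_span i h1
  have m2 := hQ.mem_span i.rev h2
  rw [Basis.mem_span_image] at m1 m2
  refine ⟨b.repr x i, ?_⟩
  conv_lhs => rw [← b.sum_repr x]
  refine Finset.sum_eq_single i (fun k _ hk => ?_) (by simp)
  suffices b.repr x k = 0 by rw [this, zero_smul]
  by_contra hne
  have k1 : k ≤ i := m1 (by simpa using hne)
  have k2 : k.rev ≤ i.rev := m2 (by simpa using hne)
  exact hk (le_antisymm k1 (Fin.rev_le_rev.1 k2))

end SplitForm

namespace THSystem

variable {d : ℕ} (Φ : THSystem K V d)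

lemma completeOrthogonalIdempotents_E : CompleteOrthogonalIdempotents Φ.E :=
  ⟨⟨fun i => (Φ.E_mul i i).trans (if_pos rfl), fun i j h => (Φ.E_mul i j).trans (if_neg h)⟩,
    Φ.sum_E⟩

lemma completeOrthogonalIdempotents_Estar : CompleteOrthogonalIdempotents Φ.Estar :=
  ⟨⟨fun i => (Φ.Es_mul i i).trans (if_pos rfl), fun i j h => (Φ.Es_mul i j).trans (if_neg h)⟩,
    Φ.sum_Es⟩

lemma mem_splitU_iff (i : Fin (d + 1)) (x : V) :
    x ∈ splitU Φ i ↔ (∀ j, i < j → Φ.Estar j x = 0) ∧ ∀ j, i.rev < j → Φ.E j x = 0 := by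
  rw [splitU, Submodule.mem_inf, Φ.completeOrthogonalIdempotents_Estar.mem_iSup_range_iff,
    Φ.completeOrthogonalIdempotents_E.mem_iSup_range_iff]
  refine and_congr (forall_congr' fun j => by rw [Fin.lt_def, not_le]) (forall_congr' fun j => ?_)
  rw [Fin.lt_def, Fin.val_rev, not_le, Nat.add_sub_add_right]

lemma isAdapted_Estar_of_eq {b : Basis (Fin (d + 1)) K V} {φ : Fin (d + 1) → K}
    (hAs : Φ.Astar = splitUpper b Φ.θs φ) : IsAdapted Φ.Estar b :=
  IsAdapted.of_triangular Φ.completeOrthogonalIdempotents_Estar Φ.Es_ne Φ.θs_inj b fun i => by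
    rw [← Φ.As_eq, hAs]
    exact splitUpper_sub_mem b _ _ i

lemma isAdapted_E_of_eq {b : Basis (Fin (d + 1)) K V}
    (hA : Φ.A = splitLower b Φ.θ) : IsAdapted Φ.E (b.reindex Fin.revPerm) :=
  IsAdapted.of_triangular Φ.completeOrthogonalIdempotents_E Φ.E_ne Φ.θ_inj _ fun i => by
    rw [← Φ.A_eq, hA]
    exact splitLower_sub_mem b _ i

lemma isSplitSeq_of_eq {b : Basis (Fin (d + 1)) K V} {φ : Fin (d + 1) → K}
    (hA : Φ.A = splitLower b Φ.θ) (hAs : Φ.Astar = splitUpper b Φ.θs φ) : IsSplitSeq Φ φ := by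
  intro i hi u hu
  obtain ⟨h1, h2⟩ := (Φ.mem_splitU_iff i u).1 hu
  obtain ⟨c, rfl⟩ := (Φ.isAdapted_Estar_of_eq hAs).exists_eq_smul (Φ.isAdapted_E_of_eq hA) i h1 h2
  have hlt := i.isLt
  have e1 : (Φ.Astar - Φ.θs i • (1 : Module.End K V)) (b i) = φ i • b ⟨i - 1, by omega⟩ := by
    simp [hAs, splitUpper_apply, show 0 < (i : ℕ) from hi]
  have e2 : (Φ.A - Φ.θ ⟨d - (i : ℕ) + 1, by omega⟩ • (1 : Module.End K V)) (b ⟨i - 1, by omega⟩) =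
      b i := by
    have hr : (⟨i - 1, by omega⟩ : Fin (d + 1)).rev = ⟨d - (i : ℕ) + 1, by omega⟩ := by
      ext; simp only [Fin.val_rev]; omega
    have hs : (i : ℕ) - 1 + 1 = i := by omega
    rw [LinearMap.sub_apply, hA, splitLower_apply, hr, dif_pos (by dsimp only; omega)]
    simp [hs]
  rw [map_smul, e1, map_smul, map_smul, e2, smul_comm]

lemma exists_of_basis (b : Basis (Fin (d + 1)) K V) {θ θs φ : Fin (d + 1) → K}
    (hθ : Function.Injective θ) (hθs : Function.Injective θs)
    (hφ : ∀ i : Fin (d + 1), 1 ≤ (i : ℕ) → φ i ≠ 0) :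
    ∃ Φ : THSystem K V d, Φ.θ = θ ∧ Φ.θs = θs ∧ IsSplitSeq Φ φ := by
  classical
  obtain ⟨P, hP, hPne, hA⟩ :=
    exists_idempotents_of_triangular _ (splitLower b θ) hθ (splitLower_sub_mem b θ)
  obtain ⟨Q, hQ, hQne, hAs⟩ :=
    exists_idempotents_of_triangular _ (splitUpper b θs φ) hθs (splitUpper_sub_mem b θs φ)
  have aP := IsAdapted.of_triangular hP hPne hθ _ (hA ▸ splitLower_sub_mem b θ)
  have aQ := IsAdapted.of_triangular hQ hQne hθs _ (hAs ▸ splitUpper_sub_mem b θs φ)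
  refine ⟨
    { A := splitLower b θ
      Astar := splitUpper b θs φ
      E := P
      Estar := Q
      θ := θ
      θs := θs
      finrank_eq := by simp [finrank_eq_card_basis b]
      θ_inj := hθ
      θs_inj := hθs
      sum_E := hP.complete
      E_mul := hP.mul_eq
      E_ne := hPne
      sum_Es := hQ.complete
      Es_mul := hQ.mul_eq
      Es_ne := hQne
      A_eq := hA
      As_eq := hAs
      EAsE_zero := aP.mul_mul_eq_zero hP (splitUpper_raises b θs hφ)
      EAsE_ne := aP.mul_mul_ne_zero hP (splitUpper_raises b θs hφ)
      EsAEs_zero := aQ.mul_mul_eq_zero hQ (splitLower_raises b θ)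
      EsAEs_ne := aQ.mul_mul_ne_zero hQ (splitLower_raises b θ) }, rfl, rfl, ?_⟩
  exact isSplitSeq_of_eq _ (b := b) rfl rfl

/-- The sequence `u, (A - θ_d) u, (A - θ_{d-1}) (A - θ_d) u, …`. -/
def splitVec (u : V) : ℕ → V
  | 0 => u
  | k + 1 => Φ.A (splitVec u k) - Φ.θ ⟨d - k, by omega⟩ • splitVec u k

lemma E_apply_A (i : Fin (d + 1)) (x : V) : Φ.E i (Φ.A x) = Φ.θ i • Φ.E i x := by
  rw [Φ.A_eq, Φ.completeOrthogonalIdempotents_E.apply_sum_smul]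

lemma Estar_apply_Astar (i : Fin (d + 1)) (x : V) :
    Φ.Estar i (Φ.Astar x) = Φ.θs i • Φ.Estar i x := by
  rw [Φ.As_eq, Φ.completeOrthogonalIdempotents_Estar.apply_sum_smul]

lemma E_apply_splitVec (u : V) (k : ℕ) (j : Fin (d + 1)) (h : d < j + k) :
    Φ.E j (Φ.splitVec u k) = 0 := by
  induction k with
  | zero => have := j.isLt; omega
  | succ k ih =>
    rw [splitVec, map_sub, map_smul, E_apply_A]
    by_cases hk : d < j + k
    · simp [ih hk]
    · rw [show (⟨d - k, by omega⟩ : Fin (d + 1)) = j from Fin.ext (by dsimp only; omega), sub_self]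

lemma Estar_apply_splitVec {u : V} (hu : ∀ j : Fin (d + 1), 0 < (j : ℕ) → Φ.Estar j u = 0)
    (h0 : Φ.Estar 0 u ≠ 0) (k : ℕ) :
    (∀ j : Fin (d + 1), k < j → Φ.Estar j (Φ.splitVec u k) = 0) ∧
      ∀ hk : k < d + 1, Φ.Estar ⟨k, hk⟩ (Φ.splitVec u k) ≠ 0 := by
  have hP := Φ.completeOrthogonalIdempotents_Estar
  induction k with
  | zero => exact ⟨hu, fun _ => h0⟩
  | succ k ih =>
    obtain ⟨ih1, ih2⟩ := ih
    have far : ∀ j l : Fin (d + 1), k + 1 ≤ j → (l : ℕ) ≠ k →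
        Φ.Estar j (Φ.A (Φ.Estar l (Φ.splitVec u k))) = 0 := by
      intro j l hj hl
      rcases lt_or_gt_of_ne hl with hlt | hgt
      · exact LinearMap.congr_fun (Φ.EsAEs_zero j l (by omega)) _
      · rw [ih1 l hgt, map_zero, map_zero]
    constructor
    · intro j hj
      rw [splitVec, map_sub, map_smul, ih1 j (by omega), smul_zero, sub_zero]
      conv_lhs => rw [← hP.sum_apply_eq (Φ.splitVec u k)]
      rw [map_sum, map_sum]
      refine Finset.sum_eq_zero fun l _ => ?_
      by_cases hl : (l : ℕ) = k
      · exact LinearMap.congr_fun (Φ.EsAEs_zero j l (by omega)) _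
      · exact far j l (by omega) hl
    · intro hk h
      let i : Fin (d + 1) := ⟨k, by omega⟩
      let j : Fin (d + 1) := ⟨k + 1, hk⟩
      have h1 : Φ.Estar j (Φ.A (Φ.Estar i (Φ.splitVec u k))) = 0 := by
        rw [← h, splitVec, map_sub, map_smul, ih1 ⟨k + 1, hk⟩ (Nat.lt_succ_self k), smul_zero, sub_zero]
        conv_rhs => rw [← hP.sum_apply_eq (Φ.splitVec u k)]
        rw [map_sum, map_sum, Finset.sum_eq_single i]
        · intro l _ hl
          exact far _ l le_rfl fun e => hl (Fin.ext e)
        · simp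
      refine Φ.EsAEs_ne j i rfl (LinearMap.ext fun x => ?_)
      obtain ⟨c, hc⟩ := hP.exists_smul_eq Φ.Es_ne (by simp [Φ.finrank_eq]) (ih2 i.isLt) x
      simp only [Module.End.mul_apply, LinearMap.zero_apply]
      rw [hc, map_smul, map_smul]
      exact (congrArg (c • ·) h1).trans (smul_zero c)

lemma exists_basis {φ : Fin (d + 1) → K} (hs : IsSplitSeq Φ φ) :
    ∃ b : Basis (Fin (d + 1)) K V, Φ.A = splitLower b Φ.θ ∧ Φ.Astar = splitUpper b Φ.θs φ := by
  have hE := Φ.completeOrthogonalIdempotents_E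
  have hP := Φ.completeOrthogonalIdempotents_Estar
  obtain ⟨y, hy⟩ : ∃ y, Φ.Estar 0 y ≠ 0 := by
    by_contra! h
    exact Φ.Es_ne 0 (LinearMap.ext h)
  have hvec := Φ.Estar_apply_splitVec (u := Φ.Estar 0 y)
    (fun j hj => hP.apply_of_ne (by rintro rfl; simp at hj) y) (by rwa [hP.apply_self])
  let v : Fin (d + 1) → V := fun i => Φ.splitVec (Φ.Estar 0 y) i
  have had : IsAdapted Φ.Estar v :=
    ⟨fun i j hij => (hvec i).1 j hij, fun i => (hvec i).2 i.isLt⟩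
  let b := basisOfLinearIndependentOfCardEqFinrank had.linearIndependent (by simp [Φ.finrank_eq])
  have hb : ∀ i, b i = Φ.splitVec (Φ.Estar 0 y) i := fun i => by simp [b, v]
  have hbad : IsAdapted Φ.Estar b := by
    have : (b : Fin (d + 1) → V) = v := funext hb
    rwa [this]
  have hAb : ∀ k : ℕ, ∀ hk : k < d + 1, Φ.A (Φ.splitVec (Φ.Estar 0 y) k) =
      Φ.θ ⟨d - k, by omega⟩ • Φ.splitVec (Φ.Estar 0 y) k + Φ.splitVec (Φ.Estar 0 y) (k + 1) :=
    fun k hk => by rw [splitVec]; abel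
  have hrev : ∀ i : Fin (d + 1), i.rev = ⟨d - i, by omega⟩ := fun i => by
    ext; simp only [Fin.val_rev]; omega
  have hA : Φ.A = splitLower b Φ.θ := by
    refine b.ext fun i => ?_
    rw [splitLower_apply, hb, hAb i i.isLt, hrev]
    congr 1
    split_ifs with h
    · rw [hb]
    · refine hE.eq_zero_of_forall fun j => Φ.E_apply_splitVec _ _ j ?_
      omega
  have haE := Φ.isAdapted_E_of_eq hA
  have hzE : ∀ i j : Fin (d + 1), i.rev < j → Φ.E j (b i) = 0 := fun i j hij => by
    simpa using haE.apply_eq_zero i.rev j hij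
  have hEs : ∀ i j : Fin (d + 1), Φ.Estar j (Φ.Astar (b i) - Φ.θs i • b i) =
      (Φ.θs j - Φ.θs i) • Φ.Estar j (b i) := fun i j => by
    rw [map_sub, map_smul, Estar_apply_Astar, sub_smul]
  refine ⟨b, hA, b.ext fun i => ?_⟩
  rw [splitUpper_apply]
  split_ifs with hi
  · have hlt := i.isLt
    let k : Fin (d + 1) := ⟨i - 1, by omega⟩
    have hk : (k.rev : ℕ) = i.rev + 1 := by simp only [k, Fin.val_rev]; omega
    obtain ⟨c, hc⟩ := hbad.exists_eq_smul haE k (x := Φ.Astar (b i) - Φ.θs i • b i)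
      (fun j hj => by
        rw [hEs]
        by_cases hij : j = i
        · rw [hij, sub_self, zero_smul]
        · rw [hbad.apply_eq_zero i j, smul_zero]
          have hj : (i : ℕ) - 1 < j := hj
          have : (j : ℕ) ≠ i := fun e => hij (Fin.ext e)
          rw [Fin.lt_def]
          omega)
      (fun j hj => by
        have hj : (k.rev : ℕ) < j := hj
        rw [map_sub, map_smul, hzE i j (by rw [Fin.lt_def]; omega), smul_zero, sub_zero]
        conv_lhs => rw [← hE.sum_apply_eq (b i)]
        rw [map_sum, map_sum]
        refine Finset.sum_eq_zero fun l _ => ?_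
        by_cases hl : i.rev < l
        · rw [hzE i l hl, map_zero, map_zero]
        · rw [Fin.lt_def] at hl
          exact LinearMap.congr_fun (Φ.EAsE_zero j l (by omega)) _)
    have hAk : Φ.A (b k) = Φ.θ k.rev • b k + b i := by
      have hs : (i : ℕ) - 1 + 1 = i := by omega
      rw [hA, splitLower_apply, dif_pos (by simp only [k]; omega)]
      simp [k, hs]
    have hmem : b i ∈ splitU Φ i :=
      (Φ.mem_splitU_iff i _).2 ⟨fun j hj => hbad.apply_eq_zero i j hj, hzE i⟩
    have h := hs i hi _ hmem
    have hr : (⟨d - (i : ℕ) + 1, by omega⟩ : Fin (d + 1)) = k.rev := by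
      ext; simp only [k, Fin.val_rev]; omega
    have hci : c • b i = φ i • b i := by
      rw [← h, hr]
      simp only [LinearMap.sub_apply, LinearMap.smul_apply, Module.End.one_apply, hc, map_smul, hAk]
      module
    have hcφ : c = φ i := smul_left_injective K (b.ne_zero i) hci
    rw [← hcφ, ← hc]
    abel
  · rw [add_zero, ← sub_eq_zero]
    have hi0 : (i : ℕ) = 0 := by omega
    refine hP.eq_zero_of_forall fun j => ?_
    rw [hEs]
    by_cases hij : j = i
    · rw [hij, sub_self, zero_smul]
    · rw [hbad.apply_eq_zero i j, smul_zero]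
      have : (j : ℕ) ≠ i := fun e => hij (Fin.ext e)
      rw [Fin.lt_def]
      omega

lemma splitSeq_ne_zero {φ : Fin (d + 1) → K} (hs : IsSplitSeq Φ φ) (i : Fin (d + 1))
    (hi : 1 ≤ (i : ℕ)) : φ i ≠ 0 := by
  obtain ⟨b, hA, hAs⟩ := Φ.exists_basis hs
  have hE := Φ.completeOrthogonalIdempotents_E
  have haE := Φ.isAdapted_E_of_eq hA
  have hzE : ∀ i j : Fin (d + 1), i.rev < j → Φ.E j (b i) = 0 := fun i j hij => by
    simpa using haE.apply_eq_zero i.rev j hij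
  have hne : Φ.E i.rev (b i) ≠ 0 := by simpa using haE.apply_ne_zero i.rev
  intro h0
  have hAi : Φ.Astar (b i) = Φ.θs i • b i := by
    rw [hAs, splitUpper_apply, h0]; simp
  have hlt := i.isLt
  let j : Fin (d + 1) := ⟨i.rev + 1, by rw [Fin.val_rev]; omega⟩
  have hj : i.rev < j := by rw [Fin.lt_def]; exact Nat.lt_succ_self _
  have h1 : Φ.E j (Φ.Astar (Φ.E i.rev (b i))) = 0 := by
    have h2 : Φ.E j (Φ.Astar (b i)) = 0 := by rw [hAi, map_smul, hzE i j hj, smul_zero]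
    rw [← h2]
    conv_rhs => rw [← hE.sum_apply_eq (b i)]
    rw [map_sum, map_sum, Finset.sum_eq_single i.rev]
    · intro l _ hl
      rcases lt_or_gt_of_ne hl with hlt | hgt
      · refine LinearMap.congr_fun (Φ.EAsE_zero j l ?_) _
        rw [Fin.lt_def] at hlt
        simp only [j]
        omega
      · rw [hzE i l hgt, map_zero, map_zero]
    · simp
  refine Φ.EAsE_ne j i.rev rfl (LinearMap.ext fun x => ?_)
  obtain ⟨c, hc⟩ := hE.exists_smul_eq Φ.E_ne (by simp [Φ.finrank_eq]) hne x
  simp only [Module.End.mul_apply, LinearMap.zero_apply]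
  rw [hc, map_smul, map_smul, h1, smul_zero]

lemma exists_equiv {W : Type*} [AddCommGroup W] [Module K W] (Ψ : THSystem K W d)
    (hθ : Φ.θ = Ψ.θ) (hθs : Φ.θs = Ψ.θs) {φ : Fin (d + 1) → K}
    (hΦ : IsSplitSeq Φ φ) (hΨ : IsSplitSeq Ψ φ) :
    ∃ γ : V ≃ₗ[K] W,
      (∀ x, γ (Φ.A x) = Ψ.A (γ x)) ∧ (∀ x, γ (Φ.Astar x) = Ψ.Astar (γ x)) ∧
      (∀ i x, γ (Φ.E i x) = Ψ.E i (γ x)) ∧ (∀ i x, γ (Φ.Estar i x) = Ψ.Estar i (γ x)) := by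
  obtain ⟨b, hA, hAs⟩ := Φ.exists_basis hΦ
  obtain ⟨b', hA', hAs'⟩ := Ψ.exists_basis hΨ
  let γ : V ≃ₗ[K] W := b.equiv b' (Equiv.refl _)
  have hγ : ∀ i, γ (b i) = b' i := fun i => by simp [γ]
  have e1 : γ.toLinearMap ∘ₗ Φ.A = Ψ.A ∘ₗ γ.toLinearMap := b.ext fun i => by
    simp only [LinearMap.comp_apply, LinearEquiv.coe_coe, hγ]
    rw [hA, hA', splitLower_apply, splitLower_apply, hθ]
    split_ifs <;> simp [hγ]
  have e2 : γ.toLinearMap ∘ₗ Φ.Astar = Ψ.Astar ∘ₗ γ.toLinearMap := b.ext fun i => by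
    simp only [LinearMap.comp_apply, LinearEquiv.coe_coe, hγ]
    rw [hAs, hAs', splitUpper_apply, splitUpper_apply, hθs]
    split_ifs <;> simp [hγ]
  have f1 : ∀ x, γ (Φ.A x) = Ψ.A (γ x) := LinearMap.congr_fun e1
  have f2 : ∀ x, γ (Φ.Astar x) = Ψ.Astar (γ x) := LinearMap.congr_fun e2
  refine ⟨γ, f1, f2, ?_, ?_⟩
  · refine Φ.completeOrthogonalIdempotents_E.intertwine Ψ.completeOrthogonalIdempotents_E
      Φ.θ_inj γ.toLinearMap fun x => ?_
    rw [← Φ.A_eq, hθ, ← Ψ.A_eq]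
    exact f1 x
  · refine Φ.completeOrthogonalIdempotents_Estar.intertwine Ψ.completeOrthogonalIdempotents_Estar
      Φ.θs_inj γ.toLinearMap fun x => ?_
    rw [← Φ.As_eq, hθs, ← Ψ.As_eq]
    exact f2 x

end THSystem

end Helpers

/-- Classification of TH systems: a parameter array
`({θ_i}, {θ*_i}, {φ_i})` is realized by a TH system over `K` iff the `θ_i` are
mutually distinct, the `θ*_i` are mutually distinct, and the `φ_i` are nonzero;
moreover the TH system is then unique up to isomorphism. -/
theorem thSystem_classification {K : Type*} [Field K] {d : ℕ}
    (θ θs φ : Fin (d + 1) → K) :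
    ((∃ Φ : THSystem K (Fin (d + 1) → K) d, Φ.θ = θ ∧ Φ.θs = θs ∧ IsSplitSeq Φ φ) ↔
      (Function.Injective θ ∧ Function.Injective θs ∧
        ∀ i : Fin (d + 1), 1 ≤ (i : ℕ) → φ i ≠ 0)) ∧
    (∀ (V W : Type) [AddCommGroup V] [Module K V] [AddCommGroup W] [Module K W]
        (Φ : THSystem K V d) (Ψ : THSystem K W d),
        Φ.θ = θ → Ψ.θ = θ → Φ.θs = θs → Ψ.θs = θs → IsSplitSeq Φ φ → IsSplitSeq Ψ φ →
        ∃ γ : V ≃ₗ[K] W,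
          (∀ x, γ (Φ.A x) = Ψ.A (γ x)) ∧ (∀ x, γ (Φ.Astar x) = Ψ.Astar (γ x)) ∧
          (∀ i x, γ (Φ.E i x) = Ψ.E i (γ x)) ∧ (∀ i x, γ (Φ.Estar i x) = Ψ.Estar i (γ x))) := by
  refine ⟨⟨?_, ?_⟩, ?_⟩
  · rintro ⟨Φ, rfl, rfl, hs⟩
    exact ⟨Φ.θ_inj, Φ.θs_inj, fun i hi => Φ.splitSeq_ne_zero hs i hi⟩
  · rintro ⟨hθ, hθs, hφ⟩
    exact THSystem.exists_of_basis (Pi.basisFun K (Fin (d + 1))) hθ hθs hφ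
  · intro V W _ _ _ _ Φ Ψ h1 h2 h3 h4 hΦ hΨ
    exact Φ.exists_equiv Ψ (h1.trans h2.symm) (h3.trans h4.symm) hΦ hΨ
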